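/- arXiv:1712.05064 — 11 statements merged into one kernel-verified Lean document; each statement's English description precedes it below -/
import Mathlib

section
/- Let λ > 0, d > 0, and let h be an incidence function satisfying (H1) and (H2). Then for every V ≥ 0 the equation λ − d·T − h(T,V) = 0 has exactly one solution T in the interval (0, λ/d]; denoting this solution by f(V), one has f(0) = λ/d and f is strictly decreasing on [0,∞), i.e. 0 ≤ V₁ < V₂ implies f(V₂) < f(V₁). -/
/-- Let `λ > 0`, `d > 0`, and let `h` be an incidence function satisfying (H1) and (H2)
(with `h (T, V) = V * hbar (T, V)`). Then for every `V ≥ 0` the equation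
`λ - d * T - h (T, V) = 0` has exactly one solution `T` in the interval `(0, λ/d]`;
moreover, any function `f` selecting this solution satisfies `f 0 = λ/d` and `f` is
strictly decreasing on `[0, ∞)`. -/
theorem unique_uninfected_level_and_strict_decrease
    (lam d : ℝ) (hlam : 0 < lam) (hd : 0 < d)
    (h hbar : ℝ → ℝ → ℝ)
    -- regularity and non-negativity (h is a C² incidence function with values in [0,∞))
    (hC2 : ContDiff ℝ 2 (Function.uncurry h))
    (hbar_cont : Continuous (Function.uncurry hbar))
    (h_nonneg : ∀ T V, 0 ≤ T → 0 ≤ V → 0 ≤ h T V)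
    (hbar_nonneg : ∀ T V, 0 ≤ T → 0 ≤ V → 0 ≤ hbar T V)
    -- (H1)
    (hH1 : ∀ T V, 0 ≤ T → 0 ≤ V → h T V = V * hbar T V)
    (hH1T0 : ∀ V, 0 ≤ V → h 0 V = 0)
    (hH1V0 : ∀ T, 0 ≤ T → h T 0 = 0)
    -- (H2): strictly increasing in each variable when both arguments are positive
    (hH2T : ∀ V, 0 < V → ∀ T₁ T₂, 0 < T₁ → T₁ < T₂ → h T₁ V < h T₂ V)
    (hH2V : ∀ T, 0 < T → ∀ V₁ V₂, 0 < V₁ → V₁ < V₂ → h T V₁ < h T V₂) :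
    (∀ V, 0 ≤ V → ∃! T, T ∈ Set.Ioc 0 (lam / d) ∧ lam - d * T - h T V = 0) ∧
    (∀ f : ℝ → ℝ,
      (∀ V, 0 ≤ V →
        f V ∈ Set.Ioc 0 (lam / d) ∧ lam - d * f V - h (f V) V = 0) →
      f 0 = lam / d ∧ ∀ V₁ V₂, 0 ≤ V₁ → V₁ < V₂ → f V₂ < f V₁) := by
  have hm : ∀ V, 0 ≤ V → ∀ T₁ T₂, 0 < T₁ → T₁ ≤ T₂ → h T₁ V ≤ h T₂ V := by
    intro V hV T₁ T₂ h1 h12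
    rcases hV.eq_or_lt with rfl | hV
    · rw [hH1V0 T₁ h1.le, hH1V0 T₂ (h1.le.trans h12)]
    · rcases h12.eq_or_lt with rfl | h12
      · exact le_rfl
      · exact (hH2T V hV T₁ T₂ h1 h12).le
  have hs : ∀ T, 0 < T → ∀ V₁ V₂, 0 ≤ V₁ → V₁ < V₂ → h T V₁ < h T V₂ := by
    intro T hT V₁ V₂ h1 h12
    rcases h1.eq_or_lt with rfl | h1
    · rw [hH1V0 T hT.le]
      exact (h_nonneg (T / 2) V₂ (by linarith) h12.le).trans_lt
        (hH2T V₂ h12 (T / 2) T (by linarith) (by linarith))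
    · exact hH2V T hT V₁ V₂ h1 h12
  have hld : 0 < lam / d := div_pos hlam hd
  have hmul : d * (lam / d) = lam := by field_simp
  refine ⟨?_, ?_⟩
  · intro V hV
    have hc : Continuous (fun T => d * T + h T V) := by
      have h2 : Continuous (fun T : ℝ => Function.uncurry h (T, V)) :=
        hC2.continuous.comp (by fun_prop)
      exact (continuous_const.mul continuous_id).add h2
    have hmem : lam ∈ Set.Icc (d * 0 + h 0 V) (d * (lam / d) + h (lam / d) V) := by
      have := h_nonneg (lam / d) V hld.le hV
      rw [hH1T0 V hV, hmul]
      constructor <;> linarith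
    obtain ⟨T, ⟨hT0, hT1⟩, hT⟩ := intermediate_value_Icc hld.le hc.continuousOn hmem
    have hT' : d * T + h T V = lam := hT
    refine ⟨T, ⟨⟨?_, hT1⟩, by linarith⟩, ?_⟩
    · rcases hT0.eq_or_lt with rfl | h0
      · rw [hH1T0 V hV] at hT'
        linarith
      · exact h0
    · rintro S ⟨⟨hS0, hS1⟩, hS⟩
      have hTpos : 0 < T := by
        rcases hT0.eq_or_lt with rfl | h0
        · rw [hH1T0 V hV] at hT'
          linarith
        · exact h0
      rcases lt_trichotomy S T with hlt | heq | hlt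
      · have := hm V hV S T hS0 hlt.le
        have := mul_lt_mul_of_pos_left hlt hd
        linarith
      · exact heq
      · have := hm V hV T S hTpos hlt.le
        have := mul_lt_mul_of_pos_left hlt hd
        linarith
  · intro f hf
    refine ⟨?_, ?_⟩
    · obtain ⟨⟨h0, _⟩, he⟩ := hf 0 le_rfl
      rw [hH1V0 _ h0.le] at he
      rw [eq_div_iff hd.ne']
      linarith
    · intro V₁ V₂ h1 h12
      by_contra! hle
      obtain ⟨⟨ha, _⟩, he1⟩ := hf V₁ h1
      obtain ⟨_, he2⟩ := hf V₂ (h1.trans h12.le)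
      have := hm V₂ (h1.trans h12.le) _ _ ha hle
      have := hs _ ha V₁ V₂ h1 h12
      have := mul_le_mul_of_nonneg_left hle hd.le
      linarith
end

section
/- Let λ > 0, d > 0, and let h be an incidence function satisfying (H1), (H2), (H3). Then the function ψ : [0,∞) → [0,∞) defined by ψ(V) = h̄(f(V), V) is strictly decreasing on [0,∞), and ψ(0) = ∂h/∂V(λ/d, 0). -/
/-- Let `λ > 0`, `d > 0`, and let `h` be an incidence function satisfying (H1), (H2), (H3),
with `h (T, V) = V * hbar (T, V)`, and let `f V` denote the unique solution
`T ∈ (0, λ/d]` of `λ - d T - h (T, V) = 0`. Then `ψ (V) = hbar (f V, V)` is strictly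
decreasing on `[0, ∞)` and `ψ 0 = ∂h/∂V (λ/d, 0)`. -/
theorem psi_strictAnti_and_value_at_zero
    (lam d : ℝ) (hlam : 0 < lam) (hd : 0 < d)
    (h hbar : ℝ → ℝ → ℝ)
    -- regularity and non-negativity (h is a C² incidence function with values in [0,∞))
    (hC2 : ContDiff ℝ 2 (Function.uncurry h))
    (hbar_cont : Continuous (Function.uncurry hbar))
    (h_nonneg : ∀ T V, 0 ≤ T → 0 ≤ V → 0 ≤ h T V)
    (hbar_nonneg : ∀ T V, 0 ≤ T → 0 ≤ V → 0 ≤ hbar T V)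
    -- (H1)
    (hH1 : ∀ T V, 0 ≤ T → 0 ≤ V → h T V = V * hbar T V)
    (hH1T0 : ∀ V, 0 ≤ V → h 0 V = 0)
    (hH1V0 : ∀ T, 0 ≤ T → h T 0 = 0)
    -- (H2): strictly increasing in each variable when both arguments are positive
    (hH2T : ∀ V, 0 < V → ∀ T₁ T₂, 0 < T₁ → T₁ < T₂ → h T₁ V < h T₂ V)
    (hH2V : ∀ T, 0 < T → ∀ V₁ V₂, 0 < V₁ → V₁ < V₂ → h T V₁ < h T V₂)
    -- (H3): hbar is nonincreasing in V and tends to 0 as V → ∞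
    (hH3mono : ∀ T, 0 ≤ T → ∀ V₁ V₂, 0 ≤ V₁ → V₁ ≤ V₂ → hbar T V₂ ≤ hbar T V₁)
    (hH3lim : ∀ T, 0 ≤ T → Filter.Tendsto (hbar T) Filter.atTop (nhds 0))
    -- f : the function assigning to V ≥ 0 the unique solution of λ - dT - h(T,V) = 0
    (f : ℝ → ℝ)
    (hf : ∀ V, 0 ≤ V →
      f V ∈ Set.Ioc 0 (lam / d) ∧ lam - d * f V - h (f V) V = 0) :
    StrictAntiOn (fun V => hbar (f V) V) (Set.Ici 0) ∧
    hbar (f 0) 0 = deriv (fun V => h (lam / d) V) 0 := by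
  have key : ∀ T V₁ V₂, 0 < T → 0 ≤ V₁ → V₁ < V₂ → h T V₁ < h T V₂ := by
    intro T V₁ V₂ hT h1 h2
    rcases h1.eq_or_lt with h0 | h0
    · subst h0
      rw [hH1V0 T hT.le]
      exact (h_nonneg T (V₂ / 2) hT.le (by linarith)).trans_lt
        (hH2V T hT _ _ (by linarith) (by linarith))
    · exact hH2V T hT _ _ h0 h2
  constructor
  · intro V₁ h1 V₂ h2 h12
    simp only [Set.mem_Ici] at h1 h2
    have hV2 : 0 < V₂ := lt_of_le_of_lt h1 h12
    obtain ⟨⟨a1, a2⟩, a3⟩ := hf V₁ h1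
    obtain ⟨⟨b1, b2⟩, b3⟩ := hf V₂ h2
    have hlt : f V₂ < f V₁ := by
      by_contra hc
      push Not at hc
      have e1 := key (f V₁) V₁ V₂ a1 h1 h12
      have e2 : h (f V₁) V₂ ≤ h (f V₂) V₂ := by
        rcases hc.eq_or_lt with e | e
        · rw [e]
        · exact (hH2T V₂ hV2 _ _ a1 e).le
      have e3 := mul_le_mul_of_nonneg_left hc hd.le
      linarith
    have c1 := hH2T V₂ hV2 _ _ b1 hlt
    rw [hH1 _ _ b1.le h2, hH1 _ _ a1.le h2] at c1
    exact (lt_of_mul_lt_mul_left c1 h2).trans_le (hH3mono _ a1.le _ _ h1 h12.le)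
  · obtain ⟨⟨a1, a2⟩, a3⟩ := hf 0 le_rfl
    have hf0 : f 0 = lam / d := by
      rw [hH1V0 _ a1.le] at a3
      rw [eq_div_iff hd.ne']
      linarith
    rw [hf0] at a1 ⊢
    have hdiff : DifferentiableAt ℝ (fun V => h (lam / d) V) 0 := by
      have hu : Differentiable ℝ (Function.uncurry h) := hC2.differentiable (by norm_num)
      have hg : DifferentiableAt ℝ (fun V : ℝ => (lam / d, V)) 0 := by fun_prop
      exact (hu (lam / d, 0)).comp (0 : ℝ) hg
    have t1 := (hasDerivWithinAt_iff_tendsto_slope' (s := Set.Ioi (0 : ℝ)) (by simp)).1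
      (hdiff.hasDerivAt.hasDerivWithinAt (s := Set.Ioi (0 : ℝ)))
    have hc : Continuous (fun V => hbar (lam / d) V) :=
      hbar_cont.comp (Continuous.prodMk_right (lam / d))
    have t2 : Filter.Tendsto (fun V => hbar (lam / d) V) (nhdsWithin 0 (Set.Ioi 0))
        (nhds (hbar (lam / d) 0)) := (hc.tendsto 0).mono_left nhdsWithin_le_nhds
    refine tendsto_nhds_unique (t2.congr' ?_) t1
    filter_upwards [self_mem_nhdsWithin] with V hV
    have hV' : (0 : ℝ) < V := hV
    rw [slope_def_field, hH1V0 _ a1.le, hH1 _ _ a1.le hV'.le]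
    rw [sub_zero, sub_zero, mul_div_cancel_left₀ _ hV'.ne']
end

section
/- Under the model hypotheses (each h_j an incidence function satisfying (H1)–(H3), all N_j > 0 and b, h, k, c > 0), the viral reproduction number is strictly smaller than the basic reproduction number: R_* < R₀. -/
/-- Under the model hypotheses (each `h j` an incidence function satisfying (H1)–(H3),
all `N j > 0` and `b, h, k, c > 0`), the viral reproduction number
`R_* = (1/c) ∑ j, N j * hbar j (f j (b h / k)) (b h / k)` is strictly smaller than the
basic reproduction number `R₀ = (1/c) ∑ j, N j * ∂h_j/∂V (λ_j/d_j, 0)`. -/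
theorem viral_reproduction_lt_basic_reproduction
    (n : ℕ) (hn : 0 < n)
    (lam d : Fin n → ℝ) (hlam : ∀ j, 0 < lam j) (hd : ∀ j, 0 < d j)
    (h hbar : Fin n → ℝ → ℝ → ℝ)
    -- regularity and non-negativity (each h j is a C² incidence function into [0,∞))
    (hC2 : ∀ j, ContDiff ℝ 2 (Function.uncurry (h j)))
    (hbar_cont : ∀ j, Continuous (Function.uncurry (hbar j)))
    (h_nonneg : ∀ j T V, 0 ≤ T → 0 ≤ V → 0 ≤ h j T V)
    (hbar_nonneg : ∀ j T V, 0 ≤ T → 0 ≤ V → 0 ≤ hbar j T V)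
    -- (H1)
    (hH1 : ∀ j T V, 0 ≤ T → 0 ≤ V → h j T V = V * hbar j T V)
    (hH1T0 : ∀ j V, 0 ≤ V → h j 0 V = 0)
    (hH1V0 : ∀ j T, 0 ≤ T → h j T 0 = 0)
    -- (H2): strictly increasing in each variable when both arguments are positive
    (hH2T : ∀ j V, 0 < V → ∀ T₁ T₂, 0 < T₁ → T₁ < T₂ → h j T₁ V < h j T₂ V)
    (hH2V : ∀ j T, 0 < T → ∀ V₁ V₂, 0 < V₁ → V₁ < V₂ → h j T V₁ < h j T V₂)
    -- (H3): hbar is nonincreasing in V and tends to 0 as V → ∞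
    (hH3mono : ∀ j T, 0 ≤ T → ∀ V₁ V₂, 0 ≤ V₁ → V₁ ≤ V₂ → hbar j T V₂ ≤ hbar j T V₁)
    (hH3lim : ∀ j T, 0 ≤ T → Filter.Tendsto (hbar j T) Filter.atTop (nhds 0))
    -- f j : the function assigning to V ≥ 0 the unique solution of λⱼ - dⱼT - hⱼ(T,V) = 0
    (f : Fin n → ℝ → ℝ)
    (hf : ∀ j V, 0 ≤ V →
      f j V ∈ Set.Ioc 0 (lam j / d j) ∧ lam j - d j * f j V - h j (f j V) V = 0)
    -- burst sizes and remaining model parameters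
    (N : Fin n → ℝ) (hN : ∀ j, 0 < N j)
    (b hh k c : ℝ) (hb : 0 < b) (hhh : 0 < hh) (hk : 0 < k) (hc : 0 < c) :
    (1 / c) * ∑ j, N j * hbar j (f j (b * hh / k)) (b * hh / k) <
      (1 / c) * ∑ j, N j * deriv (fun V => h j (lam j / d j) V) 0 := by
  have hV : 0 < b * hh / k := by positivity
  generalize b * hh / k = V₀ at hV
  apply mul_lt_mul_of_pos_left _ (by positivity)
  apply Finset.sum_lt_sum_of_nonempty
  · exact ⟨⟨0, hn⟩, Finset.mem_univ _⟩
  intro j _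
  apply mul_lt_mul_of_pos_left _ (hN j)
  obtain ⟨⟨hT, hTle⟩, heq⟩ := hf j V₀ hV.le
  generalize f j V₀ = T at hT hTle heq
  have hT0 : 0 < lam j / d j := div_pos (hlam j) (hd j)
  have hpos : 0 < h j T V₀ :=
    lt_of_le_of_lt (h_nonneg j T (V₀ / 2) hT.le (by positivity))
      (hH2V j T hT (V₀ / 2) V₀ (by positivity) (by linarith))
  have hlt : T < lam j / d j := by
    rw [lt_div_iff₀ (hd j)]
    linarith
  have h1 := hH2T j V₀ hV T _ hT hlt
  rw [hH1 j T V₀ hT.le hV.le, hH1 j _ V₀ hT0.le hV.le] at h1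
  have h2 : hbar j T V₀ < hbar j (lam j / d j) V₀ := lt_of_mul_lt_mul_left h1 hV.le
  have h3 := hH3mono j _ hT0.le 0 V₀ le_rfl hV.le
  generalize lam j / d j = T₀ at *
  have hdiff : DifferentiableAt ℝ (fun V => h j T₀ V) 0 := by
    have hcd : ContDiff ℝ 2 (fun V => Function.uncurry (h j) (T₀, V)) :=
      (hC2 j).comp (by fun_prop)
    exact (hcd.differentiable (by norm_num)) 0
  have hder := (hdiff.hasDerivAt.hasDerivWithinAt (s := Set.Ioi 0))
  rw [hasDerivWithinAt_iff_tendsto_slope' (by simp)] at hder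
  have hcont : Continuous (fun V => hbar j T₀ V) := by
    have : Continuous (fun V => Function.uncurry (hbar j) (T₀, V)) :=
      (hbar_cont j).comp (by fun_prop)
    exact this
  have hlim : Filter.Tendsto (fun V => hbar j T₀ V) (nhdsWithin 0 (Set.Ioi 0))
      (nhds (hbar j T₀ 0)) := hcont.continuousAt.tendsto.mono_left nhdsWithin_le_nhds
  have heq2 : deriv (fun V => h j T₀ V) 0 = hbar j T₀ 0 := by
    refine tendsto_nhds_unique hder (hlim.congr' ?_)
    filter_upwards [self_mem_nhdsWithin] with V hVm
    have hVp : 0 < V := hVm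
    rw [slope_def_field, hH1V0 j _ hT0.le, hH1 j _ V hT0.le hVp.le]
    rw [sub_zero, sub_zero, mul_div_cancel_left₀ _ hVp.ne']
  rw [heq2]
  linarith
end

section
/- Define F : [0,∞) → ℝ by F(V) = Σ_{j=1}^n N_j·h̄_j(f_j(V), V) − c. Under the model hypotheses, F is strictly decreasing on [0,∞), F(0) = c·(R₀ − 1), and: if R₀ > 1 there exists a unique V* > 0 with F(V*) = 0, while if R₀ ≤ 1 there is no V > 0 with F(V) = 0. (Consequently the immune-free infected steady state E* exists and is unique exactly when R₀ > 1.) -/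
/-- Define `F V = ∑ j, N j * hbar j (f j V) V - c`. Under the model hypotheses, `F` is
strictly decreasing on `[0, ∞)`, `F 0 = c * (R₀ - 1)`, and: if `R₀ > 1` there is a
unique `V* > 0` with `F V* = 0`, while if `R₀ ≤ 1` there is no `V > 0` with `F V = 0`. -/
theorem immune_free_steady_state_existence
    (n : ℕ) (hn : 0 < n)
    (lam d : Fin n → ℝ) (hlam : ∀ j, 0 < lam j) (hd : ∀ j, 0 < d j)
    (h hbar : Fin n → ℝ → ℝ → ℝ)
    -- regularity and non-negativity (each h j is a C² incidence function into [0,∞))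
    (hC2 : ∀ j, ContDiff ℝ 2 (Function.uncurry (h j)))
    (hbar_cont : ∀ j, Continuous (Function.uncurry (hbar j)))
    (h_nonneg : ∀ j T V, 0 ≤ T → 0 ≤ V → 0 ≤ h j T V)
    (hbar_nonneg : ∀ j T V, 0 ≤ T → 0 ≤ V → 0 ≤ hbar j T V)
    -- (H1)
    (hH1 : ∀ j T V, 0 ≤ T → 0 ≤ V → h j T V = V * hbar j T V)
    (hH1T0 : ∀ j V, 0 ≤ V → h j 0 V = 0)
    (hH1V0 : ∀ j T, 0 ≤ T → h j T 0 = 0)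
    -- (H2): strictly increasing in each variable when both arguments are positive
    (hH2T : ∀ j V, 0 < V → ∀ T₁ T₂, 0 < T₁ → T₁ < T₂ → h j T₁ V < h j T₂ V)
    (hH2V : ∀ j T, 0 < T → ∀ V₁ V₂, 0 < V₁ → V₁ < V₂ → h j T V₁ < h j T V₂)
    -- (H3): hbar is nonincreasing in V and tends to 0 as V → ∞
    (hH3mono : ∀ j T, 0 ≤ T → ∀ V₁ V₂, 0 ≤ V₁ → V₁ ≤ V₂ → hbar j T V₂ ≤ hbar j T V₁)
    (hH3lim : ∀ j T, 0 ≤ T → Filter.Tendsto (hbar j T) Filter.atTop (nhds 0))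
    -- f j : the function assigning to V ≥ 0 the unique solution of λⱼ - dⱼT - hⱼ(T,V) = 0
    (f : Fin n → ℝ → ℝ)
    (hf : ∀ j V, 0 ≤ V →
      f j V ∈ Set.Ioc 0 (lam j / d j) ∧ lam j - d j * f j V - h j (f j V) V = 0)
    -- burst sizes and viral clearance rate
    (N : Fin n → ℝ) (hN : ∀ j, 0 < N j)
    (c : ℝ) (hc : 0 < c)
    -- the function F and the basic reproduction number R₀
    (F : ℝ → ℝ) (hF : ∀ V, F V = (∑ j, N j * hbar j (f j V) V) - c)
    (R₀ : ℝ) (hR₀ : R₀ = (1 / c) * ∑ j, N j * deriv (fun V => h j (lam j / d j) V) 0) :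
    StrictAntiOn F (Set.Ici 0) ∧
    F 0 = c * (R₀ - 1) ∧
    (1 < R₀ → ∃! V : ℝ, 0 < V ∧ F V = 0) ∧
    (R₀ ≤ 1 → ∀ V : ℝ, 0 < V → F V ≠ 0) := by
  -- weak monotonicity in T
  have hTmono : ∀ j V, 0 ≤ V → ∀ T₁ T₂, 0 < T₁ → T₁ ≤ T₂ → h j T₁ V ≤ h j T₂ V := by
    intro j V hV T₁ T₂ h1 h12
    rcases hV.eq_or_lt with rfl | hV
    · rw [hH1V0 j T₁ h1.le, hH1V0 j T₂ (h1.le.trans h12)]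
    · rcases h12.eq_or_lt with rfl | h12
      · exact le_rfl
      · exact (hH2T j V hV T₁ T₂ h1 h12).le
  -- strict monotonicity in V, including V₁ = 0
  have hVmono : ∀ j T, 0 < T → ∀ V₁ V₂, 0 ≤ V₁ → V₁ < V₂ → h j T V₁ < h j T V₂ := by
    intro j T hT V₁ V₂ h1 h12
    rcases h1.eq_or_lt with rfl | h1
    · rw [hH1V0 j T hT.le]
      have := hH2V j T hT (V₂ / 2) V₂ (by linarith) (by linarith)
      have := h_nonneg j T (V₂ / 2) hT.le (by linarith)
      linarith
    · exact hH2V j T hT V₁ V₂ h1 h12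
  have hbarT : ∀ j V, 0 < V → ∀ T₁ T₂, 0 < T₁ → T₁ < T₂ → hbar j T₁ V < hbar j T₂ V := by
    intro j V hV T₁ T₂ h1 h12
    have := hH2T j V hV T₁ T₂ h1 h12
    rw [hH1 j T₁ V h1.le hV.le, hH1 j T₂ V (h1.trans h12).le hV.le] at this
    exact lt_of_mul_lt_mul_left this hV.le
  have hfpos : ∀ j V, 0 ≤ V → 0 < f j V := fun j V hV => (hf j V hV).1.1
  have hfle : ∀ j V, 0 ≤ V → f j V ≤ lam j / d j := fun j V hV => (hf j V hV).1.2
  have hfeq : ∀ j V, 0 ≤ V → lam j - d j * f j V - h j (f j V) V = 0 :=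
    fun j V hV => (hf j V hV).2
  -- f is strictly decreasing
  have hfanti : ∀ j V₁ V₂, 0 ≤ V₁ → V₁ < V₂ → f j V₂ < f j V₁ := by
    intro j V₁ V₂ h1 h12
    by_contra hcon
    push Not at hcon
    have h2 : 0 ≤ V₂ := h1.trans h12.le
    have e1 := hfeq j V₁ h1
    have e2 := hfeq j V₂ h2
    have a := hVmono j (f j V₂) (hfpos j V₂ h2) V₁ V₂ h1 h12
    have b := hTmono j V₁ h1 _ _ (hfpos j V₁ h1) hcon
    have e := mul_le_mul_of_nonneg_left hcon (hd j).le
    linarith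
  -- f is continuous
  have hfbound : ∀ j V₀ V, 0 ≤ V₀ → 0 ≤ V →
      |f j V - f j V₀| ≤ |h j (f j V₀) V - h j (f j V₀) V₀| / d j := by
    intro j V₀ V h0 hV
    rw [le_div_iff₀ (hd j)]
    have e1 := hfeq j V₀ h0
    have e2 := hfeq j V hV
    rcases lt_trichotomy V V₀ with hlt | rfl | hlt
    · have a := hfanti j V V₀ hV hlt
      have b := hTmono j V hV _ _ (hfpos j V₀ h0) a.le
      rw [abs_of_pos (by linarith)]
      have := neg_abs_le (h j (f j V₀) V - h j (f j V₀) V₀)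
      nlinarith
    · simp
    · have a := hfanti j V₀ V h0 hlt
      have b := hTmono j V hV _ _ (hfpos j V hV) a.le
      rw [abs_of_neg (by linarith)]
      have := le_abs_self (h j (f j V₀) V - h j (f j V₀) V₀)
      nlinarith
  have hfcont : ∀ j, ContinuousOn (f j) (Set.Ici 0) := by
    intro j V₀ h0
    have hcj : Continuous (Function.uncurry (h j)) := (hC2 j).continuous
    have hc1 : Continuous (fun V => |h j (f j V₀) V - h j (f j V₀) V₀| / d j) := by
      have : Continuous (fun V => h j (f j V₀) V) :=
        hcj.comp (Continuous.prodMk continuous_const continuous_id)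
      fun_prop
    have ht := (hc1.tendsto V₀).mono_left (nhdsWithin_le_nhds (s := Set.Ici 0))
    simp only [sub_self, abs_zero, zero_div] at ht
    unfold ContinuousWithinAt
    rw [tendsto_iff_dist_tendsto_zero]
    refine squeeze_zero' (Filter.Eventually.of_forall fun _ => dist_nonneg) ?_ ht
    filter_upwards [self_mem_nhdsWithin] with V hV
    exact hfbound j V₀ V h0 hV
  have hFcont : ContinuousOn F (Set.Ici 0) := by
    have : F = fun V => (∑ j, N j * hbar j (f j V) V) - c := funext hF
    rw [this]
    refine ContinuousOn.sub (continuousOn_finsetSum _ fun j _ => ?_) continuousOn_const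
    refine continuousOn_const.mul ?_
    exact (hbar_cont j).comp_continuousOn ((hfcont j).prodMk continuousOn_id)
  have hAnti : StrictAntiOn F (Set.Ici 0) := by
    intro V₁ h1 V₂ h2 h12
    have h1' : 0 ≤ V₁ := h1
    have h2' : 0 < V₂ := lt_of_le_of_lt h1' h12
    rw [hF, hF]
    refine sub_lt_sub_right ?_ c
    refine Finset.sum_lt_sum_of_nonempty ⟨⟨0, hn⟩, Finset.mem_univ _⟩ fun j _ => ?_
    refine mul_lt_mul_of_pos_left ?_ (hN j)
    exact (hbarT j V₂ h2' _ _ (hfpos j V₂ h2'.le) (hfanti j V₁ V₂ h1' h12)).trans_le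
      (hH3mono j _ (hfpos j V₁ h1').le V₁ V₂ h1' h12.le)
  have hderiv : ∀ j, deriv (fun V => h j (lam j / d j) V) 0 = hbar j (lam j / d j) 0 := by
    intro j
    have hT : 0 < lam j / d j := div_pos (hlam j) (hd j)
    have hdiff : DifferentiableAt ℝ (fun V => h j (lam j / d j) V) 0 := by
      have h1 : Differentiable ℝ (Function.uncurry (h j)) := (hC2 j).differentiable (by norm_num)
      have h2 : Differentiable ℝ (fun V : ℝ => ((lam j / d j, V) : ℝ × ℝ)) := by fun_prop
      exact (h1.comp h2) 0
    have hd1 := hdiff.hasDerivAt.hasDerivWithinAt (s := Set.Ioi 0)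
    have hd2 : HasDerivWithinAt (fun V => h j (lam j / d j) V) (hbar j (lam j / d j) 0)
        (Set.Ioi 0) 0 := by
      rw [hasDerivWithinAt_iff_tendsto_slope' (by simp)]
      have hcb : Continuous (fun V => hbar j (lam j / d j) V) :=
        (hbar_cont j).comp (Continuous.prodMk continuous_const continuous_id)
      refine ((hcb.tendsto 0).mono_left nhdsWithin_le_nhds).congr' ?_
      filter_upwards [self_mem_nhdsWithin] with V hV
      have hV' : 0 < V := hV
      rw [slope_def_field, hH1V0 j _ hT.le, hH1 j _ V hT.le hV'.le]
      rw [sub_zero, sub_zero, mul_div_cancel_left₀ _ hV'.ne']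
    exact (uniqueDiffWithinAt_Ioi 0).eq_deriv _ hd1 hd2
  have hf0 : ∀ j, f j 0 = lam j / d j := by
    intro j
    have e := hfeq j 0 le_rfl
    rw [hH1V0 j _ (hfpos j 0 le_rfl).le] at e
    rw [eq_div_iff (hd j).ne']
    linarith
  have hF0 : F 0 = c * (R₀ - 1) := by
    rw [hF, hR₀]
    simp only [hderiv, hf0]
    field_simp
  refine ⟨hAnti, hF0, ?_, ?_⟩
  · intro hR
    have hF0pos : 0 < F 0 := by rw [hF0]; exact mul_pos hc (by linarith)
    have hlim : Filter.Tendsto (fun V => ∑ j, N j * hbar j (lam j / d j) V) Filter.atTop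
        (nhds 0) := by
      have : Filter.Tendsto (fun V => ∑ j, N j * hbar j (lam j / d j) V) Filter.atTop
          (nhds (∑ j, N j * 0)) :=
        tendsto_finsetSum _ fun j _ =>
          (hH3lim j _ (div_pos (hlam j) (hd j)).le).const_mul (N j)
      simpa using this
    obtain ⟨M, hMc, hM0⟩ :=
      ((hlim.eventually (gt_mem_nhds hc)).and (Filter.eventually_gt_atTop 0)).exists
    have hFM : F M < 0 := by
      rw [hF]
      have : ∑ j, N j * hbar j (f j M) M ≤ ∑ j, N j * hbar j (lam j / d j) M := by
        refine Finset.sum_le_sum fun j _ => mul_le_mul_of_nonneg_left ?_ (hN j).le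
        rcases (hfle j M hM0.le).eq_or_lt with he | hlt
        · rw [he]
        · exact (hbarT j M hM0 _ _ (hfpos j M hM0.le) hlt).le
      linarith
    obtain ⟨V, hV, hV0⟩ := intermediate_value_Icc' hM0.le
      (hFcont.mono Set.Icc_subset_Ici_self) ⟨hFM.le, hF0pos.le⟩
    have hVpos : 0 < V := by
      rcases hV.1.eq_or_lt with he | hlt
      · subst he
        linarith
      · exact hlt
    refine ⟨V, ⟨hVpos, hV0⟩, ?_⟩
    rintro W ⟨hW, hW0⟩
    exact hAnti.injOn (Set.mem_Ici.2 hW.le) (Set.mem_Ici.2 hVpos.le) (hW0.trans hV0.symm)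
  · intro hR V hV hV0
    have a := hAnti (Set.mem_Ici.2 le_rfl) (Set.mem_Ici.2 hV.le) hV
    have b : c * (R₀ - 1) ≤ 0 := mul_nonpos_of_nonneg_of_nonpos hc.le (by linarith)
    linarith
end

section
/- Define G : [0,∞) → ℝ by G(A) = Σ_{j=1}^n N_j·h̄_j(f_j((b/k)(h+A)), (b/k)(h+A)) − c − q·A. Under the model hypotheses, G is strictly decreasing on [0,∞), G(0) = (Σ_{j=1}^n N_j·h̄_j(f_j(bh/k), bh/k))·(1 − 1/R_*), G(A) → −∞ as A → ∞, and: if R_* > 1 there exists a unique Â > 0 with G(Â) = 0, while if R_* ≤ 1 there is no A > 0 with G(A) = 0. (Consequently the antibody-immune infected steady state Ê exists and is unique exactly when R_* > 1.) -/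
/-- Define `G A = ∑ j, N j * hbar j (f j ((b/k)(h+A))) ((b/k)(h+A)) - c - q A`. Under the
model hypotheses, `G` is strictly decreasing on `[0, ∞)`,
`G 0 = (∑ j, N j * hbar j (f j (b h / k)) (b h / k)) * (1 - 1 / R_*)`, `G A → -∞` as
`A → ∞`, and: if `R_* > 1` there is a unique `Â > 0` with `G Â = 0`, while if
`R_* ≤ 1` there is no `A > 0` with `G A = 0`. -/
theorem antibody_immune_steady_state_existence
    (n : ℕ) (hn : 0 < n)
    (lam d : Fin n → ℝ) (hlam : ∀ j, 0 < lam j) (hd : ∀ j, 0 < d j)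
    (h hbar : Fin n → ℝ → ℝ → ℝ)
    -- regularity and non-negativity (each h j is a C² incidence function into [0,∞))
    (hC2 : ∀ j, ContDiff ℝ 2 (Function.uncurry (h j)))
    (hbar_cont : ∀ j, Continuous (Function.uncurry (hbar j)))
    (h_nonneg : ∀ j T V, 0 ≤ T → 0 ≤ V → 0 ≤ h j T V)
    (hbar_nonneg : ∀ j T V, 0 ≤ T → 0 ≤ V → 0 ≤ hbar j T V)
    -- (H1)
    (hH1 : ∀ j T V, 0 ≤ T → 0 ≤ V → h j T V = V * hbar j T V)
    (hH1T0 : ∀ j V, 0 ≤ V → h j 0 V = 0)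
    (hH1V0 : ∀ j T, 0 ≤ T → h j T 0 = 0)
    -- (H2): strictly increasing in each variable when both arguments are positive
    (hH2T : ∀ j V, 0 < V → ∀ T₁ T₂, 0 < T₁ → T₁ < T₂ → h j T₁ V < h j T₂ V)
    (hH2V : ∀ j T, 0 < T → ∀ V₁ V₂, 0 < V₁ → V₁ < V₂ → h j T V₁ < h j T V₂)
    -- (H3): hbar is nonincreasing in V and tends to 0 as V → ∞
    (hH3mono : ∀ j T, 0 ≤ T → ∀ V₁ V₂, 0 ≤ V₁ → V₁ ≤ V₂ → hbar j T V₂ ≤ hbar j T V₁)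
    (hH3lim : ∀ j T, 0 ≤ T → Filter.Tendsto (hbar j T) Filter.atTop (nhds 0))
    -- f j : the function assigning to V ≥ 0 the unique solution of λⱼ - dⱼT - hⱼ(T,V) = 0
    (f : Fin n → ℝ → ℝ)
    (hf : ∀ j V, 0 ≤ V →
      f j V ∈ Set.Ioc 0 (lam j / d j) ∧ lam j - d j * f j V - h j (f j V) V = 0)
    -- burst sizes and remaining model parameters
    (N : Fin n → ℝ) (hN : ∀ j, 0 < N j)
    (b hh k c q : ℝ) (hb : 0 < b) (hhh : 0 < hh) (hk : 0 < k) (hc : 0 < c) (hq : 0 < q)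
    -- the function G and the viral reproduction number R_*
    (G : ℝ → ℝ)
    (hG : ∀ A, G A =
      (∑ j, N j * hbar j (f j ((b / k) * (hh + A))) ((b / k) * (hh + A))) - c - q * A)
    (Rstar : ℝ)
    (hRstar : Rstar = (1 / c) * ∑ j, N j * hbar j (f j (b * hh / k)) (b * hh / k)) :
    StrictAntiOn G (Set.Ici 0) ∧
    G 0 = (∑ j, N j * hbar j (f j (b * hh / k)) (b * hh / k)) * (1 - 1 / Rstar) ∧
    Filter.Tendsto G Filter.atTop Filter.atBot ∧
    (1 < Rstar → ∃! A : ℝ, 0 < A ∧ G A = 0) ∧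
    (Rstar ≤ 1 → ∀ A : ℝ, 0 < A → G A ≠ 0) := by
  have key : ∀ j V₁ V₂, 0 < V₁ → V₁ ≤ V₂ → f j V₂ ≤ f j V₁ := by
    intro j V₁ V₂ h1 h12
    rcases h12.eq_or_lt with rfl | hlt
    · exact le_rfl
    by_contra hcon
    push Not at hcon
    obtain ⟨⟨p1, _⟩, e1⟩ := hf j V₁ h1.le
    obtain ⟨_, e2⟩ := hf j V₂ (h1.trans hlt).le
    have a1 := hH2T j V₂ (h1.trans hlt) _ _ p1 hcon
    have a2 := hH2V j _ p1 V₁ V₂ h1 hlt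
    have a3 := mul_lt_mul_of_pos_left hcon (hd j)
    linarith
  have hbmono : ∀ j V T₁ T₂, 0 < V → 0 < T₁ → T₁ ≤ T₂ → hbar j T₁ V ≤ hbar j T₂ V := by
    intro j V T₁ T₂ hV h1 h12
    rcases h12.eq_or_lt with rfl | hlt
    · exact le_rfl
    have a := hH2T j V hV _ _ h1 hlt
    rw [hH1 j _ _ h1.le hV.le, hH1 j _ _ (h1.trans hlt).le hV.le] at a
    exact (lt_of_mul_lt_mul_left a hV.le).le
  have phianti : ∀ j V₁ V₂, 0 < V₁ → V₁ ≤ V₂ →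
      hbar j (f j V₂) V₂ ≤ hbar j (f j V₁) V₁ := by
    intro j V₁ V₂ h1 h12
    have p2 := (hf j V₂ (h1.le.trans h12)).1.1
    exact (hH3mono j _ p2.le V₁ V₂ h1.le h12).trans
      (hbmono j V₁ _ _ h1 p2 (key j V₁ V₂ h1 h12))
  have phieq : ∀ j V, 0 < V → hbar j (f j V) V = (lam j - d j * f j V) / V := by
    intro j V hV
    obtain ⟨⟨p, _⟩, e⟩ := hf j V hV.le
    rw [hH1 j _ _ p.le hV.le] at e
    rw [eq_div_iff hV.ne']
    linarith
  have phipos : ∀ j V, 0 < V → 0 < hbar j (f j V) V := by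
    intro j V hV
    obtain ⟨⟨p, _⟩, e⟩ := hf j V hV.le
    have a := hH2T j V hV (f j V / 2) (f j V) (by linarith) (by linarith)
    have a2 := h_nonneg j (f j V / 2) V (by linarith) hV.le
    have a3 := a2.trans_lt a
    rw [hH1 j _ _ p.le hV.le] at a3
    exact pos_of_mul_pos_right a3 hV.le
  have V0pos : 0 < b / k * hh := by positivity
  have eV0 : b * hh / k = b / k * hh := by ring
  have bk : 0 < b / k := by positivity
  have Vge : ∀ A, 0 ≤ A → b / k * hh ≤ b / k * (hh + A) := by
    intro A hA
    exact mul_le_mul_of_nonneg_left (by linarith) bk.le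
  have fcont : ∀ j, ContinuousOn (f j) (Set.Ici (b / k * hh)) := by
    intro j
    have Kn : 0 ≤ lam j / (b / k * hh) / d j :=
      div_nonneg (div_nonneg (hlam j).le V0pos.le) (hd j).le
    have L : LipschitzOnWith ⟨lam j / (b / k * hh) / d j, Kn⟩ (f j) (Set.Ici (b / k * hh)) := by
      apply LipschitzOnWith.of_le_add_mul
      intro x hx y hy
      change f j x ≤ f j y + lam j / (b / k * hh) / d j * dist x y
      simp only [Set.mem_Ici] at hx hy
      have hx0 := V0pos.trans_le hx
      have hy0 := V0pos.trans_le hy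
      rcases le_total y x with hyx | hxy
      · have := key j y x hy0 hyx
        have := mul_nonneg Kn (dist_nonneg (x := x) (y := y))
        linarith
      · obtain ⟨⟨px, _⟩, ex⟩ := hf j x hx0.le
        obtain ⟨⟨py, _⟩, ey⟩ := hf j y hy0.le
        rw [hH1 j _ _ px.le hx0.le] at ex
        rw [hH1 j _ _ py.le hy0.le] at ey
        have m1 := hH3mono j _ py.le x y hx0.le hxy
        have m2 := hbmono j x _ _ hx0 py (key j x y hx0 hxy)
        have m3 : hbar j (f j x) x ≤ lam j / (b / k * hh) := by
          rw [phieq j x hx0]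
          have := mul_pos (hd j) px
          exact div_le_div₀ (hlam j).le (by linarith) V0pos hx
        have m4 : d j * (f j x - f j y) ≤ (y - x) * (lam j / (b / k * hh)) := by
          have n1 : y * hbar j (f j y) y ≤ y * hbar j (f j x) x :=
            mul_le_mul_of_nonneg_left (m1.trans m2) hy0.le
          have n2 := mul_le_mul_of_nonneg_left m3 (sub_nonneg.2 hxy)
          linarith
        rw [dist_comm, Real.dist_eq, abs_of_nonneg (sub_nonneg.2 hxy)]
        have m5 : f j x - f j y ≤ (y - x) * (lam j / (b / k * hh)) / d j := by
          rw [le_div_iff₀ (hd j)]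
          linarith
        have m6 : (y - x) * (lam j / (b / k * hh)) / d j
          = lam j / (b / k * hh) / d j * (y - x) := by ring
        linarith
    exact L.continuousOn
  have Gcont : ContinuousOn G (Set.Ici 0) := by
    have e : Set.EqOn G (fun A => (∑ j, N j * ((lam j - d j * f j ((b / k) * (hh + A)))
        / ((b / k) * (hh + A)))) - c - q * A) (Set.Ici 0) := by
      intro A hA
      simp only [hG]
      congr 2
      refine Finset.sum_congr rfl fun j _ => ?_
      rw [phieq j _ (V0pos.trans_le (Vge A hA))]
    refine ContinuousOn.congr ?_ e
    refine ContinuousOn.sub (ContinuousOn.sub ?_ continuousOn_const) (by fun_prop)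
    refine continuousOn_finsetSum _ fun j _ => ?_
    refine continuousOn_const.mul (ContinuousOn.div ?_ (by fun_prop) ?_)
    · refine continuousOn_const.sub (continuousOn_const.mul ?_)
      exact (fcont j).comp (t := Set.Ici (b / k * hh))
        (f := fun A => b / k * (hh + A)) (by fun_prop) (fun A hA => Vge A hA)
    · intro A hA
      exact (V0pos.trans_le (Vge A hA)).ne'
  have Ganti : StrictAntiOn G (Set.Ici 0) := by
    intro x hx y hy hxy
    rw [hG, hG]
    have s : ∑ j, N j * hbar j (f j ((b / k) * (hh + y))) ((b / k) * (hh + y)) ≤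
        ∑ j, N j * hbar j (f j ((b / k) * (hh + x))) ((b / k) * (hh + x)) := by
      refine Finset.sum_le_sum fun j _ => ?_
      exact mul_le_mul_of_nonneg_left (phianti j _ _ (V0pos.trans_le (Vge x hx))
        (mul_le_mul_of_nonneg_left (by linarith) bk.le)) (hN j).le
    have := mul_lt_mul_of_pos_left hxy hq
    linarith
  have Spos : 0 < ∑ j, N j * hbar j (f j (b * hh / k)) (b * hh / k) := by
    haveI : Nonempty (Fin n) := ⟨⟨0, hn⟩⟩
    refine Finset.sum_pos (fun j _ => ?_) Finset.univ_nonempty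
    rw [eV0]
    exact mul_pos (hN j) (phipos j _ V0pos)
  have G0 : G 0 = (∑ j, N j * hbar j (f j (b * hh / k)) (b * hh / k)) - c := by
    rw [hG, eV0]
    simp
  have Gle : ∀ A, 0 ≤ A → G A ≤ G 0 - q * A := by
    intro A hA
    have s : ∑ j, N j * hbar j (f j ((b / k) * (hh + A))) ((b / k) * (hh + A)) ≤
        ∑ j, N j * hbar j (f j (b * hh / k)) (b * hh / k) := by
      refine Finset.sum_le_sum fun j _ => ?_
      rw [eV0]
      exact mul_le_mul_of_nonneg_left (phianti j _ _ V0pos (Vge A hA)) (hN j).le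
    rw [G0, hG]
    linarith
  have zero_mem : (0 : ℝ) ∈ Set.Ici (0 : ℝ) := Set.self_mem_Ici
  refine ⟨Ganti, ?_, ?_, ?_, ?_⟩
  · rw [G0, hRstar]
    field_simp
  · have t : Filter.Tendsto (fun A : ℝ => G 0 - q * A) Filter.atTop Filter.atBot := by
      have t1 : Filter.Tendsto (fun A : ℝ => q * A) Filter.atTop Filter.atTop :=
        Filter.tendsto_id.const_mul_atTop hq
      simpa [sub_eq_add_neg] using Filter.tendsto_atBot_add_const_left Filter.atTop (G 0)
        (Filter.tendsto_neg_atTop_atBot.comp t1)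
    refine Filter.tendsto_atBot_mono' _ ?_ t
    filter_upwards [Filter.eventually_ge_atTop 0] with A hA using Gle A hA
  · intro hR
    have G0pos : 0 < G 0 := by
      rw [G0]
      rw [hRstar, one_div, inv_mul_eq_div, lt_div_iff₀ hc] at hR
      linarith
    have Bpos : 0 ≤ G 0 / q := (div_pos G0pos hq).le
    have GB : G (G 0 / q) ≤ 0 := by
      have := Gle _ Bpos
      rwa [mul_div_cancel₀ _ hq.ne', sub_self] at this
    obtain ⟨A, hA, hA0⟩ := intermediate_value_Icc' Bpos
      (Gcont.mono Set.Icc_subset_Ici_self) ⟨GB, G0pos.le⟩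
    have Ane : A ≠ 0 := by
      rintro rfl
      linarith
    refine ⟨A, ⟨lt_of_le_of_ne hA.1 Ane.symm, hA0⟩, ?_⟩
    rintro B ⟨hB, hB0⟩
    exact Ganti.injOn (Set.mem_Ici.2 hB.le) (Set.mem_Ici.2 hA.1) (hB0.trans hA0.symm)
  · intro hR A hA hA0
    have a := Ganti zero_mem (Set.mem_Ici.2 hA.le) hA
    rw [hRstar, one_div, inv_mul_eq_div, div_le_iff₀ hc] at hR
    linarith
end

section
/- Assume the model hypotheses and R₀ > 1, and let V* > 0 be the unique positive solution of Σ_{j=1}^n N_j·h̄_j(f_j(V*), V*) = c. Define the reproductive number of antibody response R_AN = k·V*/(b·h). Then: R_* < 1 if and only if R_AN < 1; R_* = 1 if and only if R_AN = 1; and R_* > 1 if and only if R_AN > 1. -/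
/-- Assume the model hypotheses and `R₀ > 1`, and let `V* > 0` be the unique positive
solution of `∑ j, N j * hbar j (f j V*) V* = c`. With the reproductive number of
antibody response `R_AN = k V* / (b h)`, one has `R_* < 1 ↔ R_AN < 1`,
`R_* = 1 ↔ R_AN = 1`, and `R_* > 1 ↔ R_AN > 1`. -/
theorem Rstar_RAN_trichotomy
    (n : ℕ) (hn : 0 < n)
    (lam d : Fin n → ℝ) (hlam : ∀ j, 0 < lam j) (hd : ∀ j, 0 < d j)
    (h hbar : Fin n → ℝ → ℝ → ℝ)
    -- regularity and non-negativity (each h j is a C² incidence function into [0,∞))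
    (hC2 : ∀ j, ContDiff ℝ 2 (Function.uncurry (h j)))
    (hbar_cont : ∀ j, Continuous (Function.uncurry (hbar j)))
    (h_nonneg : ∀ j T V, 0 ≤ T → 0 ≤ V → 0 ≤ h j T V)
    (hbar_nonneg : ∀ j T V, 0 ≤ T → 0 ≤ V → 0 ≤ hbar j T V)
    -- (H1)
    (hH1 : ∀ j T V, 0 ≤ T → 0 ≤ V → h j T V = V * hbar j T V)
    (hH1T0 : ∀ j V, 0 ≤ V → h j 0 V = 0)
    (hH1V0 : ∀ j T, 0 ≤ T → h j T 0 = 0)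
    -- (H2): strictly increasing in each variable when both arguments are positive
    (hH2T : ∀ j V, 0 < V → ∀ T₁ T₂, 0 < T₁ → T₁ < T₂ → h j T₁ V < h j T₂ V)
    (hH2V : ∀ j T, 0 < T → ∀ V₁ V₂, 0 < V₁ → V₁ < V₂ → h j T V₁ < h j T V₂)
    -- (H3): hbar is nonincreasing in V and tends to 0 as V → ∞
    (hH3mono : ∀ j T, 0 ≤ T → ∀ V₁ V₂, 0 ≤ V₁ → V₁ ≤ V₂ → hbar j T V₂ ≤ hbar j T V₁)
    (hH3lim : ∀ j T, 0 ≤ T → Filter.Tendsto (hbar j T) Filter.atTop (nhds 0))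
    -- f j : the function assigning to V ≥ 0 the unique solution of λⱼ - dⱼT - hⱼ(T,V) = 0
    (f : Fin n → ℝ → ℝ)
    (hf : ∀ j V, 0 ≤ V →
      f j V ∈ Set.Ioc 0 (lam j / d j) ∧ lam j - d j * f j V - h j (f j V) V = 0)
    -- burst sizes and remaining model parameters
    (N : Fin n → ℝ) (hN : ∀ j, 0 < N j)
    (b hh k c q : ℝ) (hb : 0 < b) (hhh : 0 < hh) (hk : 0 < k) (hc : 0 < c) (hq : 0 < q)
    -- basic and viral reproduction numbers
    (R₀ Rstar : ℝ)
    (hR₀ : R₀ = (1 / c) * ∑ j, N j * deriv (fun V => h j (lam j / d j) V) 0)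
    (hRstar : Rstar = (1 / c) * ∑ j, N j * hbar j (f j (b * hh / k)) (b * hh / k))
    (hR₀gt : 1 < R₀)
    -- V* : the unique positive solution of ∑ j, N j * hbar j (f j V) V = c
    (Vstar : ℝ) (hVstar : 0 < Vstar)
    (hVstar_eq : (∑ j, N j * hbar j (f j Vstar) Vstar) = c)
    -- the reproductive number of antibody response
    (RAN : ℝ) (hRAN : RAN = k * Vstar / (b * hh)) :
    (Rstar < 1 ↔ RAN < 1) ∧ (Rstar = 1 ↔ RAN = 1) ∧ (1 < Rstar ↔ 1 < RAN) := by
  have key : ∀ j V₁ V₂, 0 < V₁ → V₁ < V₂ → hbar j (f j V₂) V₂ < hbar j (f j V₁) V₁ := by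
    intro j V₁ V₂ h1 h12
    have h2 : 0 < V₂ := h1.trans h12
    obtain ⟨⟨p1, _⟩, e1⟩ := hf j V₁ h1.le
    obtain ⟨⟨p2, _⟩, e2⟩ := hf j V₂ h2.le
    have hlt : f j V₂ < f j V₁ := by
      by_contra hcon
      have hle : f j V₁ ≤ f j V₂ := not_lt.mp hcon
      have a1 := hH2V j (f j V₂) p2 V₁ V₂ h1 h12
      have a2 : h j (f j V₁) V₁ ≤ h j (f j V₂) V₁ := by
        rcases hle.eq_or_lt with he | hl
        · rw [he]
        · exact (hH2T j V₁ h1 _ _ p1 hl).le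
      have a3 := mul_le_mul_of_nonneg_left hle (hd j).le
      linarith
    have b1 := hH3mono j (f j V₂) p2.le V₁ V₂ h1.le h12.le
    have b2 := hH2T j V₁ h1 _ _ p2 hlt
    rw [hH1 j _ _ p2.le h1.le, hH1 j _ _ p1.le h1.le] at b2
    exact b1.trans_lt (lt_of_mul_lt_mul_left b2 h1.le)
  have anti : StrictAntiOn (fun V => ∑ j, N j * hbar j (f j V) V) (Set.Ioi 0) := by
    intro V₁ h1 V₂ _ h12
    exact Finset.sum_lt_sum_of_nonempty ⟨⟨0, hn⟩, Finset.mem_univ _⟩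
      (fun j _ => mul_lt_mul_of_pos_left (key j V₁ V₂ h1 h12) (hN j))
  have hbh : 0 < b * hh := mul_pos hb hhh
  have hW : 0 < b * hh / k := div_pos hbh hk
  have c1 := anti.lt_iff_gt (Set.mem_Ioi.mpr hW) (Set.mem_Ioi.mpr hVstar)
  have c2 := anti.lt_iff_gt (Set.mem_Ioi.mpr hVstar) (Set.mem_Ioi.mpr hW)
  simp only [hVstar_eq] at c1 c2
  have r1 : Rstar < 1 ↔ RAN < 1 := by
    rw [hRstar, hRAN, one_div_mul_eq_div, div_lt_one hc, div_lt_one hbh, c1, lt_div_iff₀ hk,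
      mul_comm]
  have r2 : 1 < Rstar ↔ 1 < RAN := by
    rw [hRstar, hRAN, one_div_mul_eq_div, one_lt_div hc, one_lt_div hbh, c2, div_lt_iff₀ hk,
      mul_comm Vstar]
  refine ⟨r1, ?_, r2⟩
  have r1' := not_congr r1
  have r2' := not_congr r2
  rw [not_lt, not_lt] at r1' r2'
  rw [le_antisymm_iff, le_antisymm_iff, r1', r2']
end

section
/- If R₀ = (1/c)·Σ_{j=1}^n a_j·N_j < 1, then every complex number s with Re s ≥ 0 satisfies s + c ≠ Σ_{j=1}^n a_j·∫₀^∞ k_j(θ)·e^{−sθ} dθ; that is, every root of the characteristic equation φ(s) = 0 has negative real part. (This gives local asymptotic stability of the infection-free steady state E⁰ when R₀ < 1.) -/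
/-- Let `c > 0`, `a j ≥ 0`, and `K j : [0, ∞) → [0, ∞)` integrable with
`N j = ∫₀^∞ K j θ dθ`. If `R₀ = (1/c) ∑ j, a j * N j < 1`, then every complex `s`
with `Re s ≥ 0` satisfies `s + c ≠ ∑ j, a j * ∫₀^∞ K j θ * exp (-s θ) dθ`; that is,
every root of the characteristic equation has negative real part. -/
theorem characteristic_roots_have_negative_real_part
    (n : ℕ) (c : ℝ) (hc : 0 < c)
    (a : Fin n → ℝ) (ha : ∀ j, 0 ≤ a j)
    (K : Fin n → ℝ → ℝ)
    (hK_nonneg : ∀ j θ, 0 ≤ θ → 0 ≤ K j θ)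
    (hK_int : ∀ j, MeasureTheory.IntegrableOn (K j) (Set.Ioi 0))
    (N : Fin n → ℝ) (hN : ∀ j, N j = ∫ θ in Set.Ioi (0 : ℝ), K j θ)
    (hR₀ : (1 / c) * ∑ j, a j * N j < 1) :
    ∀ s : ℂ, 0 ≤ s.re →
      s + (c : ℂ) ≠
        ∑ j, (a j : ℂ) * ∫ θ in Set.Ioi (0 : ℝ), (K j θ : ℂ) * Complex.exp (-s * θ) := by
  intro s hs heq
  have h1 : ‖∑ j, (a j : ℂ) * ∫ θ in Set.Ioi (0 : ℝ), (K j θ : ℂ) * Complex.exp (-s * θ)‖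
      ≤ ∑ j, a j * N j := by
    refine (norm_sum_le _ _).trans (Finset.sum_le_sum fun j _ => ?_)
    rw [norm_mul, Complex.norm_real, Real.norm_of_nonneg (ha j), hN j]
    refine mul_le_mul_of_nonneg_left ?_ (ha j)
    refine MeasureTheory.norm_integral_le_of_norm_le (hK_int j) ?_
    refine (MeasureTheory.ae_restrict_iff' measurableSet_Ioi).2 (Filter.Eventually.of_forall ?_)
    intro θ hθ
    have hθ' : 0 ≤ θ := le_of_lt hθ
    rw [norm_mul, Complex.norm_real, Real.norm_of_nonneg (hK_nonneg j θ hθ'), Complex.norm_exp]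
    refine mul_le_of_le_one_right (hK_nonneg j θ hθ') (Real.exp_le_one_iff.2 ?_)
    simp only [Complex.mul_re, Complex.neg_re, Complex.ofReal_re, Complex.ofReal_im, mul_zero,
      sub_zero]
    nlinarith [mul_nonneg hs hθ']
  have h2 : ∑ j, a j * N j < c := by
    rw [one_div, inv_mul_lt_iff₀ hc] at hR₀
    linarith
  have h3 : (s + (c : ℂ)).re ≤ ‖s + (c : ℂ)‖ := Complex.re_le_norm _
  rw [← heq] at h1
  simp only [Complex.add_re, Complex.ofReal_re] at h3
  linarith
end

section
/- If R₀ = (1/c)·Σ_{j=1}^n a_j·N_j > 1, then there exists a real number s > 0 with s + c = Σ_{j=1}^n a_j·∫₀^∞ k_j(θ)·e^{−sθ} dθ; that is, the characteristic equation φ(s) = 0 has at least one positive real root. (This gives instability of the infection-free steady state E⁰ when R₀ > 1.) -/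
/-- Let `c > 0`, `a j ≥ 0`, and `K j : [0, ∞) → [0, ∞)` integrable with
`N j = ∫₀^∞ K j θ dθ`. If `R₀ = (1/c) ∑ j, a j * N j > 1`, then there exists a real
`s > 0` with `s + c = ∑ j, a j * ∫₀^∞ K j θ * exp (-s θ) dθ`; that is, the
characteristic equation has at least one positive real root. -/
theorem characteristic_equation_has_positive_root
    (n : ℕ) (c : ℝ) (hc : 0 < c)
    (a : Fin n → ℝ) (ha : ∀ j, 0 ≤ a j)
    (K : Fin n → ℝ → ℝ)
    (hK_nonneg : ∀ j θ, 0 ≤ θ → 0 ≤ K j θ)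
    (hK_int : ∀ j, MeasureTheory.IntegrableOn (K j) (Set.Ioi 0))
    (N : Fin n → ℝ) (hN : ∀ j, N j = ∫ θ in Set.Ioi (0 : ℝ), K j θ)
    (hR₀ : 1 < (1 / c) * ∑ j, a j * N j) :
    ∃ s : ℝ, 0 < s ∧
      s + c = ∑ j, a j * ∫ θ in Set.Ioi (0 : ℝ), K j θ * Real.exp (-s * θ) := by
  have hle : ∀ j, ∀ s : ℝ, 0 ≤ s → ∀ θ ∈ Set.Ioi (0 : ℝ),
      ‖K j θ * Real.exp (-s * θ)‖ ≤ K j θ := by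
    intro j s hs θ hθ
    have hθ' : (0 : ℝ) < θ := hθ
    have h0 := hK_nonneg j θ hθ'.le
    rw [Real.norm_of_nonneg (mul_nonneg h0 (Real.exp_pos _).le)]
    apply mul_le_of_le_one_right h0
    apply Real.exp_le_one_iff.2
    nlinarith [mul_nonneg hs hθ'.le]
  have hmeas : ∀ j, ∀ s : ℝ, MeasureTheory.AEStronglyMeasurable
      (fun θ => K j θ * Real.exp (-s * θ)) (MeasureTheory.volume.restrict (Set.Ioi (0 : ℝ))) := by
    intro j s
    exact (hK_int j).aestronglyMeasurable.mul
      (by fun_prop : Continuous fun θ : ℝ => Real.exp (-s * θ)).aestronglyMeasurable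
  have hcont : ∀ j, ContinuousOn
      (fun s : ℝ => ∫ θ in Set.Ioi (0 : ℝ), K j θ * Real.exp (-s * θ)) (Set.Ici 0) := by
    intro j
    apply MeasureTheory.continuousOn_of_dominated (bound := K j)
    · intro s _
      exact hmeas j s
    · intro s hs
      exact (MeasureTheory.ae_restrict_mem measurableSet_Ioi).mono (hle j s hs)
    · exact hK_int j
    · exact Filter.Eventually.of_forall fun θ => by fun_prop
  have hbound : ∀ j, ∀ s : ℝ, 0 ≤ s →
      ∫ θ in Set.Ioi (0 : ℝ), K j θ * Real.exp (-s * θ) ≤ N j := by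
    intro j s hs
    rw [hN]
    have hae := (MeasureTheory.ae_restrict_mem (μ := MeasureTheory.volume)
      (measurableSet_Ioi (a := (0 : ℝ)))).mono (hle j s hs)
    apply MeasureTheory.integral_mono_ae ((hK_int j).mono' (hmeas j s) hae) (hK_int j)
    exact hae.mono fun θ h => (le_abs_self _).trans h
  set M := ∑ j, a j * N j with hM
  have hMc : c < M := by
    rw [one_div, inv_mul_eq_div, one_lt_div hc] at hR₀
    exact hR₀
  let f : ℝ → ℝ := fun s =>
    (∑ j, a j * ∫ θ in Set.Ioi (0 : ℝ), K j θ * Real.exp (-s * θ)) - (s + c)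
  have hf : ContinuousOn f (Set.Icc 0 M) := by
    apply ContinuousOn.sub
    · apply continuousOn_finset_sum
      intro j _
      exact continuousOn_const.mul ((hcont j).mono Set.Icc_subset_Ici_self)
    · fun_prop
  have hf0 : 0 < f 0 := by
    have : f 0 = M - c := by simp [f, hM, hN]
    linarith
  have hfM : f M ≤ 0 := by
    have : (∑ j, a j * ∫ θ in Set.Ioi (0 : ℝ), K j θ * Real.exp (-M * θ)) ≤ M :=
      Finset.sum_le_sum fun j _ =>
        mul_le_mul_of_nonneg_left (hbound j M (by linarith)) (ha j)
    simp only [f]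
    linarith
  obtain ⟨s, hs, hs0⟩ := intermediate_value_Icc' (by linarith : (0 : ℝ) ≤ M) hf ⟨hfM, hf0.le⟩
  refine ⟨s, lt_of_le_of_ne hs.1 ?_, ?_⟩
  · rintro rfl
    linarith
  · simp only [f] at hs0
    linarith
end

section
/- Let h be an incidence function satisfying (H1), (H2), (H3), and let T > 0 and V, V* > 0. Then h(T,V*) > 0, and: if V ≤ V* then V/V* ≤ h(T,V)/h(T,V*) ≤ 1, while if V ≥ V* then 1 ≤ h(T,V)/h(T,V*) ≤ V/V*. Consequently, with H(x) = x − 1 − ln x, one has H(h(T,V)/h(T,V*)) ≤ H(V/V*). -/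
/-- Let `h` be an incidence function satisfying (H1), (H2), (H3), and let `T > 0` and
`V, V* > 0`. Then `h (T, V*) > 0`; if `V ≤ V*` then
`V/V* ≤ h (T,V)/h (T,V*) ≤ 1`, while if `V ≥ V*` then `1 ≤ h (T,V)/h (T,V*) ≤ V/V*`.
Consequently, with `H x = x - 1 - ln x`, one has
`H (h (T,V)/h (T,V*)) ≤ H (V/V*)`. -/
theorem incidence_ratio_estimate
    (h hbar : ℝ → ℝ → ℝ)
    -- regularity and non-negativity (h is a C² incidence function with values in [0,∞))
    (hC2 : ContDiff ℝ 2 (Function.uncurry h))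
    (hbar_cont : Continuous (Function.uncurry hbar))
    (h_nonneg : ∀ T V, 0 ≤ T → 0 ≤ V → 0 ≤ h T V)
    (hbar_nonneg : ∀ T V, 0 ≤ T → 0 ≤ V → 0 ≤ hbar T V)
    -- (H1)
    (hH1 : ∀ T V, 0 ≤ T → 0 ≤ V → h T V = V * hbar T V)
    (hH1T0 : ∀ V, 0 ≤ V → h 0 V = 0)
    (hH1V0 : ∀ T, 0 ≤ T → h T 0 = 0)
    -- (H2): strictly increasing in each variable when both arguments are positive
    (hH2T : ∀ V, 0 < V → ∀ T₁ T₂, 0 < T₁ → T₁ < T₂ → h T₁ V < h T₂ V)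
    (hH2V : ∀ T, 0 < T → ∀ V₁ V₂, 0 < V₁ → V₁ < V₂ → h T V₁ < h T V₂)
    -- (H3): hbar is nonincreasing in V and tends to 0 as V → ∞
    (hH3mono : ∀ T, 0 ≤ T → ∀ V₁ V₂, 0 ≤ V₁ → V₁ ≤ V₂ → hbar T V₂ ≤ hbar T V₁)
    (hH3lim : ∀ T, 0 ≤ T → Filter.Tendsto (hbar T) Filter.atTop (nhds 0))
    (T V Vs : ℝ) (hT : 0 < T) (hV : 0 < V) (hVs : 0 < Vs) :
    0 < h T Vs ∧
    (V ≤ Vs → V / Vs ≤ h T V / h T Vs ∧ h T V / h T Vs ≤ 1) ∧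
    (Vs ≤ V → 1 ≤ h T V / h T Vs ∧ h T V / h T Vs ≤ V / Vs) ∧
    h T V / h T Vs - 1 - Real.log (h T V / h T Vs) ≤
      V / Vs - 1 - Real.log (V / Vs) := by
  have pos : ∀ W, 0 < W → 0 < h T W := fun W hW =>
    lt_of_le_of_lt (h_nonneg T (W / 2) hT.le (by positivity))
      (hH2V T hT (W / 2) W (by positivity) (by linarith))
  have mono : ∀ W₁ W₂, 0 < W₁ → W₁ ≤ W₂ → h T W₁ ≤ h T W₂ := by
    intro W₁ W₂ h1 h12
    rcases h12.eq_or_lt with e | l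
    · rw [e]
    · exact (hH2V T hT W₁ W₂ h1 l).le
  have cross : ∀ W₁ W₂, 0 < W₁ → W₁ ≤ W₂ → W₁ * h T W₂ ≤ W₂ * h T W₁ := by
    intro W₁ W₂ h1 h12
    have h2 : 0 < W₂ := lt_of_lt_of_le h1 h12
    rw [hH1 T W₁ hT.le h1.le, hH1 T W₂ hT.le h2.le]
    have := mul_le_mul_of_nonneg_left (hH3mono T hT.le W₁ W₂ h1.le h12) (mul_pos h1 h2).le
    nlinarith
  have hp := pos Vs hVs
  have hq := pos V hV
  have A : V ≤ Vs → V / Vs ≤ h T V / h T Vs ∧ h T V / h T Vs ≤ 1 := by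
    intro hle
    refine ⟨?_, ?_⟩
    · rw [div_le_div_iff₀ hVs hp]
      linarith [cross V Vs hV hle]
    · rw [div_le_one hp]
      exact mono V Vs hV hle
  have B : Vs ≤ V → 1 ≤ h T V / h T Vs ∧ h T V / h T Vs ≤ V / Vs := by
    intro hle
    refine ⟨?_, ?_⟩
    · rw [one_le_div hp]
      exact mono Vs V hVs hle
    · rw [div_le_div_iff₀ hp hVs]
      linarith [cross Vs V hVs hle]
  refine ⟨hp, A, B, ?_⟩
  have ha : 0 < h T V / h T Vs := div_pos hq hp
  have hb : 0 < V / Vs := div_pos hV hVs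
  generalize h T V / h T Vs = a at *
  generalize V / Vs = b at *
  have hlog := Real.log_le_sub_one_of_pos (div_pos hb ha)
  rw [Real.log_div hb.ne' ha.ne'] at hlog
  have key : 0 ≤ (b - a) * (a - 1) := by
    rcases le_total V Vs with hle | hle
    · obtain ⟨h1, h2⟩ := A hle
      nlinarith
    · obtain ⟨h1, h2⟩ := B hle
      nlinarith
  have key2 : b / a - 1 ≤ b - a := by
    rw [sub_le_iff_le_add, div_le_iff₀ ha]
    nlinarith
  linarith
end

section
/- Let λ > 0, d ≥ 0, let φ : [0,∞) → ℝ be continuous, and let T : [0,∞) → ℝ be differentiable with T′(t) = λ − d·T(t) − φ(t) for all t ≥ 0, where φ(t) = 0 whenever T(t) = 0, and T(0) ≥ 0. Then T(t) ≥ 0 for all t ≥ 0 and T(t) > 0 for all t > 0. -/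
/-- Let `λ > 0`, `d ≥ 0`, `φ` continuous on `[0, ∞)`, and let `T` satisfy
`T' t = λ - d * T t - φ t` on `[0, ∞)`, where `φ t = 0` whenever `T t = 0`, and
`T 0 ≥ 0`. Then `T t ≥ 0` for all `t ≥ 0` and `T t > 0` for all `t > 0`. -/
theorem target_cells_stay_positive
    (lam d : ℝ) (hlam : 0 < lam) (hd : 0 ≤ d)
    (φ T : ℝ → ℝ)
    (hφ_cont : ContinuousOn φ (Set.Ici 0))
    (hT' : ∀ t, 0 ≤ t →
      HasDerivWithinAt T (lam - d * T t - φ t) (Set.Ici 0) t)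
    (hφ0 : ∀ t, 0 ≤ t → T t = 0 → φ t = 0)
    (hT0 : 0 ≤ T 0) :
    (∀ t, 0 ≤ t → 0 ≤ T t) ∧ (∀ t, 0 < t → 0 < T t) := by
  have hnn : ∀ t, 0 ≤ t → 0 ≤ T t := by
    intro t ht
    have key := image_le_of_deriv_right_lt_deriv_boundary' (f := fun x => -T x)
      (f' := fun x => -(lam - d * T x - φ x)) (a := 0) (b := t)
      (B := fun _ => (0 : ℝ)) (B' := fun _ => (0 : ℝ))
      (fun x hx => ((hT' x hx.1).continuousWithinAt.mono Set.Icc_subset_Ici_self).neg)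
      (fun x hx => ((hT' x hx.1).mono (Set.Ici_subset_Ici.mpr hx.1)).neg)
      (by simpa using hT0) continuousOn_const
      (fun x _ => hasDerivWithinAt_const x _ (0 : ℝ))
      (by
        intro x hx h
        have h0 : T x = 0 := by simpa using h
        simp only [h0, hφ0 x hx.1 h0]
        linarith)
    have h := key (Set.right_mem_Icc.mpr ht)
    simpa using h
  refine ⟨hnn, fun t ht => lt_of_le_of_ne (hnn t ht.le) fun h => ?_⟩
  have h0 : T t = 0 := h.symm
  have hder := (hT' t ht.le).hasDerivAt (Ici_mem_nhds ht)
  have hmin : IsLocalMin T t := by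
    filter_upwards [Ici_mem_nhds ht] with x hx
    rw [h0]
    exact hnn x hx
  have hz := hmin.hasDerivAt_eq_zero hder
  rw [h0, hφ0 t ht.le h0] at hz
  linarith
end

section
/- Let δ* > 0 and ω > 0, let B : [0,∞) → ℝ and i⁰ : [0,∞) → ℝ be given, and define i(θ,t) = B(t−θ)·e^{−δ*θ} for 0 ≤ θ < t and i(θ,t) = i⁰(θ−t)·e^{−δ*t} for θ ≥ t ≥ 0. Then for all θ ≥ ω and t ≥ ω one has i(θ,t) = e^{−δ*ω}·i(θ−ω, t−ω). Consequently, if P(θ) = 0 for 0 ≤ θ < ω and P(θ) = P* for θ ≥ ω, and if i⁰ is integrable and B is locally integrable, then for every t ≥ ω: ∫₀^∞ P(θ)·i(θ,t) dθ = P*·e^{−δ*ω}·∫₀^∞ i(θ, t−ω) dθ. -/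
/-- Solution of the transport equation `∂i/∂θ + ∂i/∂t = -δ* i` with boundary data
`i (0, t) = B t` and initial data `i (θ, 0) = i⁰ θ`, for a constant death rate `δ*`. -/
noncomputable def constRateSol (δs : ℝ) (B i0 : ℝ → ℝ) (θ t : ℝ) : ℝ :=
  if θ < t then B (t - θ) * Real.exp (-δs * θ)
  else i0 (θ - t) * Real.exp (-δs * t)

/-- Let `δ* > 0` and `ω > 0`, and let `i` be as above. Then for all `θ ≥ ω` and `t ≥ ω`
one has `i (θ, t) = exp (-δ* ω) * i (θ - ω, t - ω)`. Consequently, if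
`P θ = 0` for `θ < ω` and `P θ = P*` for `θ ≥ ω`, and if `i⁰` is integrable and `B`
is locally integrable, then for every `t ≥ ω`:
`∫₀^∞ P θ * i (θ, t) dθ = P* * exp (-δ* ω) * ∫₀^∞ i (θ, t - ω) dθ`. -/
theorem viral_production_delay_identity
    (δs ω Ps : ℝ) (hδs : 0 < δs) (hω : 0 < ω)
    (B i0 : ℝ → ℝ)
    (hB : MeasureTheory.LocallyIntegrable B)
    (hi0 : MeasureTheory.IntegrableOn i0 (Set.Ici 0)) :
    (∀ θ t, ω ≤ θ → ω ≤ t →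
      constRateSol δs B i0 θ t =
        Real.exp (-δs * ω) * constRateSol δs B i0 (θ - ω) (t - ω)) ∧
    (∀ t, ω ≤ t →
      (∫ θ in Set.Ioi (0 : ℝ),
          (if θ < ω then (0 : ℝ) else Ps) * constRateSol δs B i0 θ t) =
        Ps * Real.exp (-δs * ω) *
          ∫ θ in Set.Ioi (0 : ℝ), constRateSol δs B i0 θ (t - ω)) := by
  have key : ∀ θ t, ω ≤ θ → ω ≤ t →
      constRateSol δs B i0 θ t =
        Real.exp (-δs * ω) * constRateSol δs B i0 (θ - ω) (t - ω) := by
    intro θ t _ _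
    unfold constRateSol
    by_cases h : θ < t
    · rw [if_pos h, if_pos (by linarith), show t - ω - (θ - ω) = t - θ by ring,
        show -δs * θ = -δs * ω + -δs * (θ - ω) by ring, Real.exp_add]
      ring
    · rw [if_neg h, if_neg (by linarith), show θ - ω - (t - ω) = θ - t by ring,
        show -δs * t = -δs * ω + -δs * (t - ω) by ring, Real.exp_add]
      ring
  refine ⟨key, fun t ht => ?_⟩
  rw [← MeasureTheory.integral_const_mul, ← MeasureTheory.integral_indicator measurableSet_Ioi,
    ← MeasureTheory.integral_indicator measurableSet_Ioi,
    ← MeasureTheory.integral_sub_right_eq_self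
      (Set.indicator (Set.Ioi (0 : ℝ))
        (fun θ => Ps * Real.exp (-δs * ω) * constRateSol δs B i0 θ (t - ω))) ω]
  apply MeasureTheory.integral_congr_ae
  have hne : ∀ᵐ θ : ℝ, θ ≠ ω := by
    simp [MeasureTheory.ae_iff]
  filter_upwards [hne] with θ hθ
  rcases lt_or_gt_of_ne hθ with h | h
  · have h2 : ¬ (0 < θ - ω) := by linarith
    rw [Set.indicator_of_notMem (s := Set.Ioi (0 : ℝ)) (a := θ - ω) h2]
    simp [Set.indicator, h]
  · rw [Set.indicator_of_mem (Set.mem_Ioi.2 (by linarith)),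
      Set.indicator_of_mem (Set.mem_Ioi.2 (by linarith)), if_neg (by linarith),
      key θ t h.le ht]
    ring
end
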